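/- arXiv:1907.06816 — 2 statements merged into one kernel-verified Lean document; each statement's English description precedes it below -/
import Mathlib

section
/- Let n ≥ 1, p > 2 and q ∈ ℝ with q > 1 - p, and let u : ℝ^n → ℝ be a positive, bounded, twice continuously differentiable function satisfying -Δu = u^q |∇u|^p at every point of ℝ^n. Then the function x ↦ u(x)^{q+1} |∇u(x)|^{p-2} is bounded on ℝ^n. -/
/-- The Laplacian of `u : ℝⁿ → ℝ` at `x`, defined as the sum of the pure second
partial derivatives in the coordinate directions. -/
noncomputable def lap {n : ℕ} (u : EuclideanSpace ℝ (Fin n) → ℝ)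
    (x : EuclideanSpace ℝ (Fin n)) : ℝ :=
  ∑ i : Fin n,
    fderiv ℝ (fun y => fderiv ℝ u y (EuclideanSpace.single i (1 : ℝ))) x
      (EuclideanSpace.single i (1 : ℝ))

/-- At a global maximum, the second derivative is nonpositive. -/
theorem second_deriv_nonpos_of_forall_le {h h' : ℝ → ℝ} {c : ℝ}
    (hh : ∀ t, HasDerivAt h (h' t) t) (hc : HasDerivAt h' c 0) (hmax : ∀ t, h t ≤ h 0) :
    c ≤ 0 := by
  by_contra! hpos
  have hmax0 : IsLocalMax h 0 := Filter.Eventually.of_forall hmax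
  have hderiv : deriv h = h' := funext fun t => (hh t).deriv
  have hmin0 : IsLocalMin h 0 := isLocalMin_of_deriv_deriv_pos
    (by rw [hderiv, hc.deriv]; exact hpos) hmax0.deriv_eq_zero (hh 0).continuousAt
  have hconst : h =ᶠ[nhds 0] fun _ => h 0 := by
    filter_upwards [hmin0] with t ht using le_antisymm (hmax t) ht
  have hderiv0 : deriv (deriv h) 0 = 0 := by
    rw [hconst.deriv.deriv_eq]
    simp
  rw [hderiv, hc.deriv] at hderiv0
  exact hpos.ne' hderiv0

section Lipschitz

variable {E : Type*} [NormedAddCommGroup E] [InnerProductSpace ℝ E]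

theorem hasDerivAt_comp_line {f : E → ℝ} (hf : Differentiable ℝ f) (x e : E) (t : ℝ) :
    HasDerivAt (fun s : ℝ => f (x + s • e)) (fderiv ℝ f (x + t • e) e) t := by
  have hline : HasDerivAt (fun s : ℝ => x + s • e) e t := by
    simpa using ((hasDerivAt_id t).smul_const e).const_add x
  exact (hf (x + t • e)).hasFDerivAt.comp_hasDerivAt t hline

theorem differentiable_fderiv_apply {f : E → ℝ} (hf : ContDiff ℝ 2 f) (e : E) :
    Differentiable ℝ fun y => fderiv ℝ f y e :=
  ((hf.fderiv_right (m := 1) (by norm_num)).differentiable one_ne_zero).clm_apply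
    (differentiable_const e)

/-- Second-order condition for `f (x + z) - f (y + z) - ε * ‖x + z‖ ^ 2` at a maximum `z = 0`. -/
theorem second_fderiv_sub_le {f : E → ℝ} (hf : ContDiff ℝ 2 f) {x y : E} {ε : ℝ}
    (hmax : ∀ z, f (x + z) - f (y + z) - ε * ‖x + z‖ ^ 2 ≤ f x - f y - ε * ‖x‖ ^ 2) (e : E) :
    fderiv ℝ (fun z => fderiv ℝ f z e) x e - fderiv ℝ (fun z => fderiv ℝ f z e) y e
      ≤ 2 * ε * ‖e‖ ^ 2 := by
  have hd := hf.differentiable two_ne_zero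
  have hd' := differentiable_fderiv_apply hf e
  have hx := hasDerivAt_comp_line hd' x e 0
  have hy := hasDerivAt_comp_line hd' y e 0
  have hsq : ∀ t : ℝ, HasDerivAt (fun s : ℝ => ε * ‖x + s • e‖ ^ 2)
      (ε * (2 * (inner ℝ x e + t * ‖e‖ ^ 2))) t := by
    intro t
    have hline : HasDerivAt (fun s : ℝ => x + s • e) e t := by
      simpa using ((hasDerivAt_id t).smul_const e).const_add x
    have hd := hline.norm_sq.const_mul ε
    rwa [inner_add_left, real_inner_smul_left, real_inner_self_eq_norm_sq] at hd
  have hlin : HasDerivAt (fun t : ℝ => ε * (2 * (inner ℝ x e + t * ‖e‖ ^ 2)))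
      (ε * (2 * ‖e‖ ^ 2)) 0 := by
    simpa using ((((hasDerivAt_id (0 : ℝ)).mul_const (‖e‖ ^ 2)).const_add
      (inner ℝ x e)).const_mul 2).const_mul ε
  have key := second_deriv_nonpos_of_forall_le
    (fun t => ((hasDerivAt_comp_line hd x e t).sub (hasDerivAt_comp_line hd y e t)).sub (hsq t))
    ((hx.sub hy).sub hlin) (fun t => by simpa using hmax (t • e))
  simp only [zero_smul, add_zero] at key
  linarith

/-- If `x` maximizes `f - ε ‖·‖ ^ 2` compared with the translate of `f` by `y - x`, the
derivatives at `x` and `y` differ by at most `2 ε ‖x‖`. -/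
theorem norm_fderiv_sub_le {f : E → ℝ} (hf : Differentiable ℝ f) {x y : E} {ε : ℝ} (hε : 0 ≤ ε)
    (hmax : ∀ z, f (x + z) - f (y + z) - ε * ‖x + z‖ ^ 2 ≤ f x - f y - ε * ‖x‖ ^ 2) :
    ‖fderiv ℝ f x - fderiv ℝ f y‖ ≤ 2 * ε * ‖x‖ := by
  refine ContinuousLinearMap.opNorm_le_bound _ (by positivity) fun e => ?_
  have hline : HasDerivAt (fun s : ℝ => x + s • e) e 0 := by
    simpa using ((hasDerivAt_id (0 : ℝ)).smul_const e).const_add x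
  have hd := ((hasDerivAt_comp_line hf x e 0).sub (hasDerivAt_comp_line hf y e 0)).sub
    (hline.norm_sq.const_mul ε)
  have hloc : IsLocalMax ((fun s : ℝ => f (x + s • e)) - (fun s : ℝ => f (y + s • e))
      - fun s : ℝ => ε * ‖x + s • e‖ ^ 2) 0 :=
    Filter.Eventually.of_forall fun t => by simpa using hmax (t • e)
  have h0 := hloc.hasDerivAt_eq_zero hd
  simp only [zero_smul, add_zero] at h0
  have heq : (fderiv ℝ f x - fderiv ℝ f y) e = 2 * ε * inner ℝ x e := by
    rw [sub_apply]
    linarith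
  rw [heq, norm_mul, Real.norm_of_nonneg (by positivity), mul_assoc (2 * ε)]
  exact mul_le_mul_of_nonneg_left (norm_inner_le_norm x e) (by positivity)

/-- If `f + K ‖· - x‖` is minimal at `y ≠ x`, then the derivative of `f` at `y` has norm `K`. -/
theorem norm_fderiv_eq_of_forall_le {f : E → ℝ} (hf : Differentiable ℝ f) {x y : E} {K : ℝ}
    (hK : 0 ≤ K) (hxy : y ≠ x) (hmin : ∀ z, f y + K * ‖y - x‖ ≤ f z + K * ‖z - x‖) :
    ‖fderiv ℝ f y‖ = K := by
  have : Nontrivial E := ⟨y, x, hxy⟩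
  have hnorm : DifferentiableAt ℝ (fun z : E => ‖z‖) (y - x) :=
    differentiableAt_id.norm ℝ (sub_ne_zero.2 hxy)
  have hcomp : HasFDerivAt (fun z : E => ‖z - x‖) (fderiv ℝ (fun z : E => ‖z‖) (y - x)) y := by
    exact hnorm.hasFDerivAt.comp y ((hasFDerivAt_id y).sub_const x)
  have hloc : IsLocalMin (f + fun z => K * ‖z - x‖) y :=
    Filter.Eventually.of_forall hmin
  have h0 := hloc.hasFDerivAt_eq_zero ((hf y).hasFDerivAt.add (hcomp.const_mul K))
  rw [eq_neg_of_add_eq_zero_left h0, norm_neg, norm_smul, norm_fderiv_norm hnorm, mul_one,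
    Real.norm_of_nonneg hK]

/-- The penalized doubled function attains its maximum. -/
theorem exists_forall_doubled_le [FiniteDimensional ℝ E] {f : E → ℝ} (hf : Continuous f)
    (hpos : ∀ x, 0 < f x) {M K ε : ℝ} (hM : ∀ x, f x ≤ M) (hK : 0 < K) (hε : 0 < ε) {x₀ y₀ : E}
    (h₀ : 0 ≤ f x₀ - f y₀ - K * ‖x₀ - y₀‖ - ε * ‖x₀‖ ^ 2) :
    ∃ x y, ∀ x' y', f x' - f y' - K * ‖x' - y'‖ - ε * ‖x'‖ ^ 2
      ≤ f x - f y - K * ‖x - y‖ - ε * ‖x‖ ^ 2 := by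
  have : ProperSpace E := FiniteDimensional.proper ℝ E
  let Φ : E × E → ℝ := fun z => f z.1 - f z.2 - K * ‖z.1 - z.2‖ - ε * ‖z.1‖ ^ 2
  have hΦ : Continuous Φ := by fun_prop
  have hev : ∀ᶠ z in Filter.cocompact (E × E), Φ z ≤ Φ (x₀, y₀) := by
    filter_upwards [(isCompact_closedBall (0 : E × E) (M / ε + 1 + M / K)).compl_mem_cocompact]
      with z hz
    by_contra! hlt
    apply hz
    have hpos' : 0 < f z.1 - f z.2 - K * ‖z.1 - z.2‖ - ε * ‖z.1‖ ^ 2 := h₀.trans_lt hlt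
    have h1 := hM z.1
    have h2 := hpos z.2
    have hM0 : 0 < M := (hpos z.1).trans_le h1
    have h3 : 0 ≤ K * ‖z.1 - z.2‖ := by positivity
    have h4 : 0 ≤ ε * ‖z.1‖ ^ 2 := by positivity
    have hx : ‖z.1‖ ≤ M / ε + 1 := by
      have : ‖z.1‖ ^ 2 ≤ M / ε := by
        rw [le_div_iff₀ hε]
        linarith
      nlinarith [sq_nonneg (‖z.1‖ - 1), norm_nonneg z.1]
    have hd : ‖z.1 - z.2‖ ≤ M / K := by
      rw [le_div_iff₀ hK]
      linarith
    have hy : ‖z.2‖ ≤ ‖z.1‖ + ‖z.1 - z.2‖ := by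
      have := norm_sub_le z.1 (z.1 - z.2)
      rwa [sub_sub_cancel] at this
    have hMK : 0 < M / K := by positivity
    rw [mem_closedBall_zero_iff, Prod.norm_def]
    exact max_le (by linarith) (by linarith)
  obtain ⟨z, hz⟩ := hΦ.exists_forall_ge' _ hev
  exact ⟨z.1, z.2, fun x' y' => hz (x', y')⟩

end Lipschitz

theorem exists_pos_forall_mul_lt {a b c α β γ : ℝ} (ha : 0 < α) (hb : 0 < β) (hc : 0 < γ) :
    ∃ ε > 0, ε * a < α ∧ ε * b < β ∧ ε * c < γ := by
  have key : ∀ c b : ℝ, 0 < b → ∀ᶠ ε : ℝ in nhdsWithin 0 (Set.Ioi 0), ε * c < b := by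
    intro c b hb
    have : Filter.Tendsto (fun ε : ℝ => ε * c) (nhds 0) (nhds 0) := by
      simpa using (show Continuous fun ε : ℝ => ε * c by fun_prop).tendsto 0
    exact (this.mono_left nhdsWithin_le_nhds).eventually_lt_const hb
  obtain ⟨ε, ⟨⟨h1, h2⟩, h3⟩, h4⟩ :=
    (((key a α ha).and (key b β hb)).and (key c γ hc)).and self_mem_nhdsWithin |>.exists
  exact ⟨ε, h4, h1, h2, h3⟩

section Laplacian

variable {n : ℕ}

/-- A positive bounded solution of `-Δw = G(|∇w|) / w` on the whole space is `K`-Lipschitz as soon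
as `G K > 0`. -/
theorem sub_le_mul_norm_of_lap_eq {w : EuclideanSpace ℝ (Fin n) → ℝ} (hw : ContDiff ℝ 2 w)
    (hpos : ∀ x, 0 < w x) {M : ℝ} (hM : ∀ x, w x ≤ M) {G : ℝ → ℝ} {K : ℝ} (hK : 0 < K)
    (hG : ContinuousAt G K) (hGK : 0 < G K)
    (hlap : ∀ x, lap w x = -(G ‖fderiv ℝ w x‖ / w x)) (x₀ y₀ : EuclideanSpace ℝ (Fin n)) :
    w x₀ - w y₀ ≤ K * ‖x₀ - y₀‖ := by
  by_contra! hlt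
  obtain ⟨δ, hδ, hδeq⟩ : ∃ δ > 0, δ = w x₀ - w y₀ - K * ‖x₀ - y₀‖ :=
    ⟨_, sub_pos.2 hlt, rfl⟩
  have hM0 : 0 < M := (hpos x₀).trans_le (hM x₀)
  set A : ℝ := G K * δ / (2 * M ^ 2) with hA
  have hA0 : 0 < A := by positivity
  obtain ⟨η, hη, hGη⟩ := Metric.continuousAt_iff.1 hG (A * δ / 8) (by positivity)
  obtain ⟨ε, hε, hε₀, hεn, hεη⟩ := exists_pos_forall_mul_lt (a := ‖x₀‖ ^ 2) (b := 2 * n) (c := 4 * M)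
    (half_pos hδ) (show 0 < A / 4 by positivity) (show 0 < η ^ 2 by positivity)
  have hd := hw.differentiable two_ne_zero
  obtain ⟨x, y, hxy⟩ := exists_forall_doubled_le hd.continuous hpos hM hK hε
    (x₀ := x₀) (y₀ := y₀) (by linarith)
  have hval : δ / 2 ≤ w x - w y - K * ‖x - y‖ - ε * ‖x‖ ^ 2 := by
    linarith [hxy x₀ y₀]
  have hKxy : 0 ≤ K * ‖x - y‖ := by positivity
  have hεx : 0 ≤ ε * ‖x‖ ^ 2 := by positivity
  have hwy := hpos y
  have hwx := hpos x
  have hgap : w y + δ / 2 ≤ w x := by linarith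
  have hne : y ≠ x := by
    rintro rfl
    linarith
  have hmax : ∀ z, w (x + z) - w (y + z) - ε * ‖x + z‖ ^ 2 ≤ w x - w y - ε * ‖x‖ ^ 2 := by
    intro z
    have := hxy (x + z) (y + z)
    rw [add_sub_add_right_eq_sub] at this
    linarith
  have hDy : ‖fderiv ℝ w y‖ = K := norm_fderiv_eq_of_forall_le hd hK.le hne fun z => by
    have := hxy x z
    rw [norm_sub_rev y x, norm_sub_rev z x]
    linarith
  have hDx : |‖fderiv ℝ w x‖ - K| < η := by
    rw [← hDy]
    refine ((abs_norm_sub_norm_le _ _).trans (norm_fderiv_sub_le hd hε.le hmax)).trans_lt ?_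
    refine lt_of_pow_lt_pow_left₀ 2 hη.le (lt_of_le_of_lt ?_ hεη)
    have : ε * ‖x‖ ^ 2 ≤ M := by linarith [hM x]
    calc (2 * ε * ‖x‖) ^ 2 = ε * (4 * (ε * ‖x‖ ^ 2)) := by ring
      _ ≤ ε * (4 * M) := by gcongr
  have hGx : G ‖fderiv ℝ w x‖ ≤ G K + A * δ / 8 := by
    have := hGη (show dist ‖fderiv ℝ w x‖ K < η from hDx)
    linarith [(abs_lt.1 (show |G ‖fderiv ℝ w x‖ - G K| < _ from this)).2]
  have hlapsub : lap w x - lap w y ≤ ε * (2 * n) := by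
    rw [lap, lap, ← Finset.sum_sub_distrib]
    refine (Finset.sum_le_sum fun i _ => second_fderiv_sub_le hw hmax _).trans (le_of_eq ?_)
    simp
    ring
  rw [hlap, hlap, hDy] at hlapsub
  have hx1 : G ‖fderiv ℝ w x‖ / w x ≤ G K / w x + A / 4 := by
    calc G ‖fderiv ℝ w x‖ / w x ≤ (G K + A * δ / 8) / w x := by gcongr
      _ = G K / w x + A * δ / 8 / w x := add_div _ _ _
      _ ≤ G K / w x + A * δ / 8 / (δ / 2) := by gcongr; linarith
      _ = G K / w x + A / 4 := by field_simp; ring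
  have hdiff : A ≤ G K / w y - G K / w x := by
    calc A = G K * (δ / 2) / (M * M) := by rw [hA]; field_simp
      _ ≤ G K * (w x - w y) / (w y * w x) := by
        gcongr
        · exact mul_nonneg hGK.le (by linarith)
        · linarith
        · exact hM y
        · exact hM x
      _ = G K / w y - G K / w x := by field_simp
  linarith

theorem norm_gradient_eq (u : EuclideanSpace ℝ (Fin n) → ℝ) (x : EuclideanSpace ℝ (Fin n)) :
    ‖gradient u x‖ = ‖fderiv ℝ u x‖ := by
  simp [gradient]

theorem sum_sq_fderiv_single (u : EuclideanSpace ℝ (Fin n) → ℝ) (x : EuclideanSpace ℝ (Fin n)) :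
    ∑ i, fderiv ℝ u x (EuclideanSpace.single i 1) ^ 2 = ‖fderiv ℝ u x‖ ^ 2 := by
  rw [← norm_gradient_eq, EuclideanSpace.real_norm_sq_eq]
  refine Finset.sum_congr rfl fun i _ => ?_
  rw [← toDual_gradient, InnerProductSpace.toDual_apply_apply, EuclideanSpace.inner_single_right]
  simp only [one_mul, conj_trivial]

theorem fderiv_rpow_of_pos {u : EuclideanSpace ℝ (Fin n) → ℝ} (hu : Differentiable ℝ u)
    (hpos : ∀ x, 0 < u x) (a : ℝ) (x : EuclideanSpace ℝ (Fin n)) :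
    fderiv ℝ (fun y => u y ^ a) x = (a * u x ^ (a - 1)) • fderiv ℝ u x :=
  ((hu x).hasFDerivAt.rpow_const (Or.inl (hpos x).ne')).fderiv

theorem lap_rpow {u : EuclideanSpace ℝ (Fin n) → ℝ} (hu : ContDiff ℝ 2 u)
    (hpos : ∀ x, 0 < u x) (a : ℝ) (x : EuclideanSpace ℝ (Fin n)) :
    lap (fun y => u y ^ a) x
      = a * u x ^ (a - 1) * lap u x + a * (a - 1) * u x ^ (a - 2) * ‖fderiv ℝ u x‖ ^ 2 := by
  have hd := hu.differentiable two_ne_zero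
  rw [← sum_sq_fderiv_single, lap, lap, Finset.mul_sum, Finset.mul_sum,
    ← Finset.sum_add_distrib]
  refine Finset.sum_congr rfl fun i _ => ?_
  set e := EuclideanSpace.single i (1 : ℝ)
  have hfun : (fun y => fderiv ℝ (fun z => u z ^ a) y e)
      = fun y => a * u y ^ (a - 1) * fderiv ℝ u y e := by
    funext y
    rw [fderiv_rpow_of_pos hd hpos]
    rfl
  have hpow := ((hd x).hasFDerivAt.rpow_const (p := a - 1) (Or.inl (hpos x).ne')).const_mul a
  have hmul : HasFDerivAt (fun y => a * u y ^ (a - 1) * fderiv ℝ u y e) _ x :=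
    hpow.mul (differentiable_fderiv_apply hu e x).hasFDerivAt
  rw [hfun, hmul.fderiv]
  simp only [add_apply, smul_apply, smul_eq_mul]
  rw [show a - 1 - 1 = a - 2 by ring]
  ring

end Laplacian

theorem exists_pos_rpow_sub_sq_pos {p c : ℝ} (hp : 2 < p) (hc : 0 < c) (d : ℝ) :
    ∃ K > 0, 0 < c * K ^ p - d * K ^ 2 := by
  have htend : Filter.Tendsto (fun K : ℝ => c * K ^ (p - 2)) Filter.atTop Filter.atTop :=
    (tendsto_rpow_atTop (by linarith)).const_mul_atTop hc
  obtain ⟨K, hKd, hK⟩ := ((htend.eventually_gt_atTop d).and (Filter.eventually_gt_atTop 0)).exists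
  refine ⟨K, hK, ?_⟩
  have hsplit : K ^ p = K ^ (p - 2) * K ^ 2 := by
    rw [← Real.rpow_natCast, ← Real.rpow_add hK]
    norm_num
  rw [hsplit]
  have : 0 < K ^ 2 := by positivity
  nlinarith

/-- The power of `u` for which the equation takes the form `-Δw = G(|∇w|) / w`. -/
theorem lap_rpow_eq_of_equation {n : ℕ} {p q a : ℝ} (ha : 0 < a) (hapq : a * (p - 2) = q + p - 1)
    {u : EuclideanSpace ℝ (Fin n) → ℝ} (hpos : ∀ x, 0 < u x) (hu : ContDiff ℝ 2 u)
    (heq : ∀ x, -lap u x = u x ^ q * ‖gradient u x‖ ^ p) (x : EuclideanSpace ℝ (Fin n)) :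
    lap (fun y => u y ^ a) x = -((a ^ (1 - p) * ‖fderiv ℝ (fun y => u y ^ a) x‖ ^ p
      - (a - 1) / a * ‖fderiv ℝ (fun y => u y ^ a) x‖ ^ 2) / u x ^ a) := by
  have hux := hpos x
  have hlap : lap u x = -(u x ^ q * ‖fderiv ℝ u x‖ ^ p) := by
    rw [← norm_gradient_eq, ← heq, neg_neg]
  rw [lap_rpow hu hpos, hlap, fderiv_rpow_of_pos (hu.differentiable two_ne_zero) hpos, norm_smul,
    Real.norm_of_nonneg (by positivity)]
  have hap : a ^ (1 - p) * a ^ p = a := by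
    rw [← Real.rpow_add ha, sub_add_cancel, Real.rpow_one]
  have hup : (u x ^ (a - 1)) ^ p = u x ^ (a - 1) * u x ^ q * u x ^ a := by
    rw [← Real.rpow_mul hux.le, ← Real.rpow_add hux, ← Real.rpow_add hux]
    congr 1
    linarith
  have hu2 : (u x ^ (a - 1)) ^ 2 = u x ^ (a - 2) * u x ^ a := by
    rw [← Real.rpow_natCast, ← Real.rpow_mul hux.le, ← Real.rpow_add hux]
    congr 1
    push_cast
    ring
  have hua : 0 < u x ^ a := by positivity
  rw [Real.mul_rpow (by positivity) (norm_nonneg _), Real.mul_rpow ha.le (by positivity), hup,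
    mul_pow, mul_pow, hu2, eq_comm, neg_eq_iff_eq_neg, div_eq_iff hua.ne', ← mul_assoc, ← mul_assoc,
    hap]
  field_simp
  ring

/-- **Gradient bound** (Lemma 2.1): for `p > 2` and `q > 1 - p` (cf. Remark 2.1), if `u` is a positive bounded
classical solution of `-Δu = u^q |∇u|^p` in `ℝⁿ`, then `u^{q+1} |∇u|^{p-2}` is bounded. -/
theorem gradient_bound_extended {n : ℕ} (hn : 1 ≤ n) {p q : ℝ} (hp : 2 < p) (hq : 1 - p < q)
    (u : EuclideanSpace ℝ (Fin n) → ℝ)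
    (hu_pos : ∀ x, 0 < u x)
    (hu_bdd : ∃ M : ℝ, ∀ x, u x ≤ M)
    (hu_C2 : ContDiff ℝ 2 u)
    (heq : ∀ x, -lap u x = u x ^ q * ‖gradient u x‖ ^ p) :
    ∃ C : ℝ, ∀ x, u x ^ (q + 1) * ‖gradient u x‖ ^ (p - 2) ≤ C := by
  obtain ⟨M, hM⟩ := hu_bdd
  have hp2 : 0 < p - 2 := by linarith
  obtain ⟨a, ha, hapq⟩ : ∃ a > 0, a * (p - 2) = q + p - 1 :=
    ⟨(q + p - 1) / (p - 2), div_pos (by linarith) hp2, div_mul_cancel₀ _ hp2.ne'⟩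
  obtain ⟨K, hK, hGK⟩ := exists_pos_rpow_sub_sq_pos hp
    (show 0 < a ^ (1 - p) by positivity) ((a - 1) / a)
  have hcont : ContinuousAt (fun s : ℝ => a ^ (1 - p) * s ^ p - (a - 1) / a * s ^ 2) K :=
    (continuousAt_const.mul (Real.continuousAt_rpow_const K p (Or.inl hK.ne'))).sub
      (by fun_prop)
  have hlip := sub_le_mul_norm_of_lap_eq (hu_C2.rpow_const_of_ne fun x => (hu_pos x).ne')
    (fun x => Real.rpow_pos_of_pos (hu_pos x) a)
    (fun x => Real.rpow_le_rpow (hu_pos x).le (hM x) ha.le) hK hcont hGK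
    (lap_rpow_eq_of_equation ha hapq hu_pos hu_C2 heq)
  refine ⟨(K / a) ^ (p - 2), fun x => ?_⟩
  have hux := hu_pos x
  have hD : ‖fderiv ℝ (fun y => u y ^ a) x‖ ≤ K := by
    refine norm_fderiv_le_of_lip' ℝ hK.le (Filter.Eventually.of_forall fun y => abs_le.2 ⟨?_, hlip y x⟩)
    have := hlip x y
    rw [norm_sub_rev] at this
    linarith
  rw [fderiv_rpow_of_pos (hu_C2.differentiable two_ne_zero) hu_pos, norm_smul,
    Real.norm_of_nonneg (by positivity), ← norm_gradient_eq] at hD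
  have hexp : u x ^ (q + 1) = (u x ^ (a - 1)) ^ (p - 2) := by
    rw [← Real.rpow_mul hux.le]
    congr 1
    linarith
  rw [hexp, ← Real.mul_rpow (by positivity) (norm_nonneg _)]
  refine Real.rpow_le_rpow (by positivity) ?_ hp2.le
  rw [le_div_iff₀ ha]
  linarith
end

section
/- Let n ≥ 1 and let f, g : ℝ^n × [0,∞)² × ℝ^n × ℝ^n → ℝ be nonnegative functions such that for each M > 0 there is a constant K(M) > 0 with u·f(x,u,v,ξ,ζ) ≤ K(M)|ξ|² and v·g(x,u,v,ξ,ζ) ≤ K(M)|ζ|² for all x ∈ ℝ^n, all (u,v) ∈ [0,M]² and all ξ, ζ in the closed ball of radius M in ℝ^n. Let (u, v) be a pair of nonnegative, twice continuously differentiable functions on ℝ^n satisfying -Δu(x) = f(x, u(x), v(x), ∇u(x), ∇v(x)) and -Δv(x) = g(x, u(x), v(x), ∇u(x), ∇v(x)) for all x ∈ ℝ^n, and suppose u, v, |∇u| and |∇v| are all bounded on ℝ^n. Then u and v are constant. -/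
open MeasureTheory Filter Topology

section BumpAverage

variable {n : ℕ}

/-- The compactly supported radial weight `max 0 (1 - ‖z‖²)`. -/
noncomputable def radialBump (z : EuclideanSpace ℝ (Fin n)) : ℝ := max 0 (1 - ‖z‖ ^ 2)

lemma continuous_radialBump : Continuous (radialBump (n := n)) := by
  unfold radialBump; fun_prop

lemma radialBump_nonneg (z : EuclideanSpace ℝ (Fin n)) : 0 ≤ radialBump z := le_max_left _ _

lemma radialBump_eq_zero {z : EuclideanSpace ℝ (Fin n)} (hz : z ∉ Metric.closedBall 0 1) :
    radialBump z = 0 := by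
  simp only [Metric.mem_closedBall, dist_zero_right, not_le] at hz
  exact max_eq_left (by nlinarith)

lemma hasCompactSupport_radialBump : HasCompactSupport (radialBump (n := n)) :=
  HasCompactSupport.intro (isCompact_closedBall 0 1) fun _ hz => radialBump_eq_zero hz

lemma integral_radialBump_pos :
    0 < ∫ z : EuclideanSpace ℝ (Fin n), radialBump z :=
  continuous_radialBump.integral_pos_of_hasCompactSupport_nonneg_nonzero
    hasCompactSupport_radialBump radialBump_nonneg (x := 0) (by simp [radialBump])

lemma integrable_radialBump_mul {w : EuclideanSpace ℝ (Fin n) → ℝ} (hw : Continuous w) :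
    Integrable fun z => radialBump z * w z :=
  (continuous_radialBump.mul hw).integrable_of_hasCompactSupport
    hasCompactSupport_radialBump.mul_right

lemma hasDerivAt_max_zero_sq (s : ℝ) :
    HasDerivAt (fun s : ℝ => max 0 s ^ 2) (2 * max 0 s) s := by
  rcases lt_trichotomy s 0 with h | rfl | h
  · rw [max_eq_left h.le, mul_zero]
    refine (hasDerivAt_const s (0 : ℝ)).congr_of_eventuallyEq ?_
    filter_upwards [Iio_mem_nhds h] with r hr
    simp [max_eq_left (Set.mem_Iio.1 hr).le]
  · rw [max_self, mul_zero, hasDerivAt_iff_isLittleO]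
    have h2 : (fun s : ℝ => max 0 s ^ 2) =O[𝓝 0] fun s => s ^ 2 := by
      refine Asymptotics.isBigO_of_le _ fun s => ?_
      rw [norm_pow, norm_pow]
      gcongr
      rw [Real.norm_eq_abs, Real.norm_eq_abs, abs_of_nonneg (le_max_left _ _)]
      exact max_le (abs_nonneg _) (le_abs_self _)
    simpa using h2.trans_isLittleO (Asymptotics.isLittleO_pow_id one_lt_two)
  · rw [max_eq_right h.le]
    have h1 : HasDerivAt (fun s : ℝ => s ^ 2) (2 * s) s := by simpa using hasDerivAt_pow 2 s
    refine h1.congr_of_eventuallyEq ?_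
    filter_upwards [Ioi_mem_nhds h] with r hr
    simp [max_eq_right (Set.mem_Ioi.1 hr).le]

lemma hasFDerivAt_radialBump_sq (z : EuclideanSpace ℝ (Fin n)) :
    HasFDerivAt (fun z => radialBump z ^ 2) (-(4 * radialBump z) • innerSL ℝ z) z := by
  have h1 : HasFDerivAt (fun z : EuclideanSpace ℝ (Fin n) => 1 - ‖z‖ ^ 2)
      (-(2 • innerSL ℝ z)) z := (hasStrictFDerivAt_norm_sq z).hasFDerivAt.const_sub 1
  refine ((hasDerivAt_max_zero_sq (1 - ‖z‖ ^ 2)).comp_hasFDerivAt z h1).congr_fderiv ?_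
  ext y
  simp [radialBump]
  ring

lemma fderiv_radialBump_sq_single (z : EuclideanSpace ℝ (Fin n)) (i : Fin n) :
    fderiv ℝ (fun z => radialBump z ^ 2) z (EuclideanSpace.single i (1 : ℝ))
      = -(4 * radialBump z) * z i := by
  rw [(hasFDerivAt_radialBump_sq z).fderiv]
  simp [EuclideanSpace.inner_single_right]

lemma integral_partial_mul_coord {h : EuclideanSpace ℝ (Fin n) → ℝ} (hh : ContDiff ℝ 1 h)
    (i : Fin n) :
    4 * ∫ z, radialBump z * (h z * z i)
      = ∫ z, radialBump z ^ 2 * fderiv ℝ h z (EuclideanSpace.single i (1 : ℝ)) := by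
  have hc : Continuous fun z => fderiv ℝ h z (EuclideanSpace.single i (1 : ℝ)) :=
    (hh.continuous_fderiv one_ne_zero).clm_apply continuous_const
  have hz : Continuous fun z : EuclideanSpace ℝ (Fin n) => z i := by fun_prop
  have hb := continuous_radialBump (n := n)
  have key := integral_mul_fderiv_eq_neg_fderiv_mul_of_integrable (μ := volume)
    (f := h) (g := fun z => radialBump z ^ 2) (v := EuclideanSpace.single i (1 : ℝ))
    ?_ ?_ ?_ (fun z _ => hh.differentiable one_ne_zero z)
    (fun z _ => (hasFDerivAt_radialBump_sq z).differentiableAt)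
  · simp only [fderiv_radialBump_sq_single] at key
    have e1 : ∫ z, h z * (-(4 * radialBump z) * z i)
        = -(4 * ∫ z, radialBump z * (h z * z i)) := by
      rw [← integral_const_mul, ← integral_neg]
      congr 1; ext z; ring
    rw [e1, neg_inj] at key
    rw [key]
    congr 1; ext z; ring
  · refine (integrable_radialBump_mul (hb.mul hc)).congr (.of_forall fun z => ?_)
    simp only [Pi.mul_apply]; ring
  · simp only [fderiv_radialBump_sq_single]
    refine (integrable_radialBump_mul ((hh.continuous.mul hz).const_smul (-4 : ℝ))).congr
      (.of_forall fun z => ?_)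
    simp only [Pi.smul_apply, Pi.mul_apply, smul_eq_mul]; ring
  · refine (integrable_radialBump_mul (hb.mul hh.continuous)).congr (.of_forall fun z => ?_)
    simp only [Pi.mul_apply]; ring

lemma hasDerivAt_bumpAverage {w : EuclideanSpace ℝ (Fin n) → ℝ} (hw : ContDiff ℝ 1 w)
    (x : EuclideanSpace ℝ (Fin n)) (t : ℝ) :
    HasDerivAt (fun s : ℝ => ∫ z, radialBump z * w (x + s • z))
      (∫ z, radialBump z * fderiv ℝ w (x + t • z) z) t := by
  have hb := continuous_radialBump (n := n)
  have hw0 := hw.continuous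
  have hw1 := hw.continuous_fderiv one_ne_zero
  have hF : Continuous fun q : ℝ × EuclideanSpace ℝ (Fin n) =>
      radialBump q.2 * fderiv ℝ w (x + q.1 • q.2) q.2 :=
    (hb.comp continuous_snd).mul
      ((hw1.comp (by fun_prop)).clm_apply continuous_snd)
  obtain ⟨C, hC⟩ := ((isCompact_closedBall t 1).prod
    (isCompact_closedBall (0 : EuclideanSpace ℝ (Fin n)) 1)).exists_bound_of_continuousOn
      hF.continuousOn
  refine (hasDerivAt_integral_of_dominated_loc_of_deriv_le
    (bound := (Metric.closedBall (0 : EuclideanSpace ℝ (Fin n)) 1).indicator fun _ => C)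
    (F' := fun s z => radialBump z * fderiv ℝ w (x + s • z) z)
    (Metric.closedBall_mem_nhds t one_pos) ?_ ?_ ?_ ?_ ?_ ?_).2
  · exact .of_forall fun s =>
      (hb.mul (hw0.comp (by fun_prop))).aestronglyMeasurable
  · exact integrable_radialBump_mul (hw0.comp (by fun_prop))
  · exact (hF.comp (by fun_prop : Continuous fun z => (t, z))).aestronglyMeasurable
  · refine .of_forall fun z s hs => ?_
    by_cases hz : z ∈ Metric.closedBall (0 : EuclideanSpace ℝ (Fin n)) 1
    · rw [Set.indicator_of_mem hz]
      exact hC (s, z) ⟨hs, hz⟩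
    · simp [Set.indicator_of_notMem hz, radialBump_eq_zero hz]
  · exact (integrable_indicator_iff measurableSet_closedBall).2
      (integrableOn_const (isCompact_closedBall _ _).measure_lt_top.ne)
  · refine .of_forall fun z s _ => ?_
    have h1 : HasDerivAt (fun s : ℝ => x + s • z) z s := by
      simpa using ((hasDerivAt_id s).smul_const z).const_add x
    exact (((hw.differentiable one_ne_zero) (x + s • z)).hasFDerivAt.comp_hasDerivAt s h1).const_mul
      (radialBump z)

lemma integral_radialBump_mul_fderiv {w : EuclideanSpace ℝ (Fin n) → ℝ} (hw : ContDiff ℝ 2 w)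
    (x : EuclideanSpace ℝ (Fin n)) (t : ℝ) :
    4 * ∫ z, radialBump z * fderiv ℝ w (x + t • z) z
      = t * ∫ z, radialBump z ^ 2 * lap w (x + t • z) := by
  have hd : ∀ i : Fin n, ContDiff ℝ 1
      fun y => fderiv ℝ w y (EuclideanSpace.single i (1 : ℝ)) := fun i =>
    (hw.fderiv_right (by norm_num)).clm_apply contDiff_const
  have ha : ContDiff ℝ 1 fun z : EuclideanSpace ℝ (Fin n) => x + t • z := by fun_prop
  have hb := continuous_radialBump (n := n)
  have hexp : ∀ z : EuclideanSpace ℝ (Fin n), radialBump z * fderiv ℝ w (x + t • z) z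
      = ∑ i, radialBump z *
        (fderiv ℝ w (x + t • z) (EuclideanSpace.single i (1 : ℝ)) * z i) := by
    intro z
    have hz : z = ∑ i, z i • EuclideanSpace.single i (1 : ℝ) := by
      ext j; simp [Finset.sum_apply, Pi.single_apply]
    rw [← Finset.mul_sum]
    conv_lhs => rw [hz, map_sum]
    rw [← hz]
    simp [mul_comm]
  have hchain : ∀ i (z : EuclideanSpace ℝ (Fin n)),
      fderiv ℝ (fun z => fderiv ℝ w (x + t • z) (EuclideanSpace.single i (1 : ℝ))) z
        (EuclideanSpace.single i (1 : ℝ))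
      = t * fderiv ℝ (fun y => fderiv ℝ w y (EuclideanSpace.single i (1 : ℝ))) (x + t • z)
        (EuclideanSpace.single i (1 : ℝ)) := by
    intro i z
    have h1 : HasFDerivAt (fun z : EuclideanSpace ℝ (Fin n) => x + t • z)
        (t • ContinuousLinearMap.id ℝ _) z := ((hasFDerivAt_id z).const_smul t).const_add x
    have h2 := ((hd i).differentiable one_ne_zero (x + t • z)).hasFDerivAt.comp z h1
    simp only [Function.comp_def] at h2
    rw [h2.fderiv]
    simp
  simp_rw [hexp]
  rw [integral_finsetSum, Finset.mul_sum]
  · simp_rw [lap, Finset.mul_sum]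
    rw [integral_finsetSum, Finset.mul_sum]
    · refine Finset.sum_congr rfl fun i _ => ?_
      refine (integral_partial_mul_coord ((hd i).comp ha) i).trans ?_
      simp_rw [Function.comp_def, hchain]
      rw [← integral_const_mul]
      congr 1; ext z; ring
    · intro i _
      have hc : Continuous fun z : EuclideanSpace ℝ (Fin n) =>
          fderiv ℝ (fun y => fderiv ℝ w y (EuclideanSpace.single i (1 : ℝ))) (x + t • z)
            (EuclideanSpace.single i (1 : ℝ)) :=
        (((hd i).continuous_fderiv one_ne_zero).comp ha.continuous).clm_apply continuous_const
      refine (integrable_radialBump_mul (hb.mul hc)).congr (.of_forall fun z => ?_)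
      simp only [Pi.mul_apply]; ring
  · intro i _
    exact integrable_radialBump_mul
      (((hd i).continuous.comp ha.continuous).mul (by fun_prop))

/-- The mean value inequality for subharmonic functions, with weight `radialBump`. -/
lemma integral_radialBump_mul_le_of_lap_nonneg {w : EuclideanSpace ℝ (Fin n) → ℝ}
    (hw : ContDiff ℝ 2 w) (hlap : ∀ x, 0 ≤ lap w x) (x : EuclideanSpace ℝ (Fin n)) {t : ℝ}
    (ht : 0 ≤ t) :
    (∫ z : EuclideanSpace ℝ (Fin n), radialBump z) * w x
      ≤ ∫ z, radialBump z * w (x + t • z) := by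
  have hder := hasDerivAt_bumpAverage (hw.of_le one_le_two) x
  have hmono : MonotoneOn (fun s : ℝ => ∫ z, radialBump z * w (x + s • z)) (Set.Ici 0) := by
    refine monotoneOn_of_hasDerivWithinAt_nonneg (convex_Ici 0)
      (fun s _ => (hder s).continuousAt.continuousWithinAt)
      (fun s _ => (hder s).hasDerivWithinAt) fun s hs => ?_
    rw [interior_Ici, Set.mem_Ioi] at hs
    have h1 := integral_radialBump_mul_fderiv hw x s
    have h2 : 0 ≤ ∫ z, radialBump z ^ 2 * lap w (x + s • z) :=
      integral_nonneg fun z => mul_nonneg (sq_nonneg _) (hlap _)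
    have h3 := mul_nonneg hs.le h2
    linarith
  have := hmono Set.self_mem_Ici ht ht
  simpa [integral_mul_const] using this

lemma tendsto_integral_abs_radialBump_sub :
    Tendsto (fun h : EuclideanSpace ℝ (Fin n) => ∫ z, |radialBump z - radialBump (z + h)|)
      (𝓝 0) (𝓝 0) := by
  have hb := continuous_radialBump (n := n)
  have hcont := continuousOn_integral_of_compact_support (μ := volume)
    (f := fun h z : EuclideanSpace ℝ (Fin n) => |radialBump z - radialBump (z + h)|)
    (s := Metric.closedBall 0 1) (isCompact_closedBall (0 : EuclideanSpace ℝ (Fin n)) 2)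
    (by
      apply Continuous.continuousOn
      exact ((hb.comp continuous_snd).sub
        (hb.comp (continuous_snd.add continuous_fst))).abs)
    (by
      intro h z hh hz
      simp only [Metric.mem_closedBall, dist_zero_right, not_le] at hh hz
      have h1 : ‖z‖ ≤ ‖z + h‖ + ‖h‖ := by simpa using norm_sub_le (z + h) h
      rw [radialBump_eq_zero, radialBump_eq_zero, sub_zero, abs_zero] <;>
        simp only [Metric.mem_closedBall, dist_zero_right, not_le] <;> linarith)
  simpa using (hcont.continuousAt (Metric.closedBall_mem_nhds _ one_pos)).tendsto

lemma abs_bumpAverage_sub_le {w : EuclideanSpace ℝ (Fin n) → ℝ} (hw : Continuous w) {M : ℝ}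
    (hM : ∀ x, |w x| ≤ M) (x y : EuclideanSpace ℝ (Fin n)) {t : ℝ} (ht : t ≠ 0) :
    |(∫ z, radialBump z * w (x + t • z)) - ∫ z, radialBump z * w (y + t • z)|
      ≤ M * ∫ z, |radialBump z - radialBump (z + t⁻¹ • (x - y))| := by
  have hb := continuous_radialBump (n := n)
  have hs : ∫ z, radialBump z * w (y + t • z)
      = ∫ z, radialBump (z + t⁻¹ • (x - y)) * w (x + t • z) := by
    rw [← integral_add_right_eq_self _ (t⁻¹ • (x - y))]
    congr 1; ext z
    rw [smul_add, smul_inv_smul₀ ht]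
    congr 2; abel
  have hw' : Continuous fun z => w (x + t • z) := hw.comp (by fun_prop)
  have hbs : HasCompactSupport fun z => radialBump (z + t⁻¹ • (x - y)) :=
    hasCompactSupport_radialBump.comp_homeomorph (Homeomorph.addRight _)
  have hbc : Continuous fun z => radialBump (z + t⁻¹ • (x - y)) := hb.comp (by fun_prop)
  have hbi : Integrable fun z => radialBump (z + t⁻¹ • (x - y)) * w (x + t • z) :=
    (hbc.mul hw').integrable_of_hasCompactSupport hbs.mul_right
  rw [hs, ← integral_sub (integrable_radialBump_mul hw') hbi, ← integral_const_mul,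
    ← Real.norm_eq_abs]
  refine norm_integral_le_of_norm_le ?_ (.of_forall fun z => ?_)
  · exact ((hb.integrable_of_hasCompactSupport hasCompactSupport_radialBump).sub
      (hbc.integrable_of_hasCompactSupport hbs)).abs.const_mul M
  · rw [← sub_mul, norm_mul, mul_comm, Real.norm_eq_abs, Real.norm_eq_abs]
    gcongr
    exact hM _

lemma tendsto_bumpAverage_sub {w : EuclideanSpace ℝ (Fin n) → ℝ} (hw : Continuous w) {M : ℝ}
    (hM : ∀ x, |w x| ≤ M) (x y : EuclideanSpace ℝ (Fin n)) :
    Tendsto (fun t : ℝ =>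
      (∫ z, radialBump z * w (x + t • z)) - ∫ z, radialBump z * w (y + t • z))
      atTop (𝓝 0) := by
  have h0 : Tendsto (fun t : ℝ => t⁻¹ • (x - y)) atTop (𝓝 0) := by
    simpa using (tendsto_inv_atTop_zero (𝕜 := ℝ)).smul_const (x - y)
  have h1 := (tendsto_integral_abs_radialBump_sub.comp h0).const_mul M
  rw [mul_zero] at h1
  refine squeeze_zero_norm' ?_ h1
  filter_upwards [eventually_ne_atTop 0] with t ht
  exact abs_bumpAverage_sub_le hw hM x y ht

end BumpAverage

section Liouville

variable {n : ℕ}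

lemma lap_neg (u : EuclideanSpace ℝ (Fin n) → ℝ) (x : EuclideanSpace ℝ (Fin n)) :
    lap (fun y => -u y) x = -lap u x := by
  simp [lap, fderiv_fun_neg]

lemma norm_gradient_sq {u : EuclideanSpace ℝ (Fin n) → ℝ} (x : EuclideanSpace ℝ (Fin n)) :
    ‖gradient u x‖ ^ 2 = ∑ i, fderiv ℝ u x (EuclideanSpace.single i (1 : ℝ)) ^ 2 := by
  rw [EuclideanSpace.real_norm_sq_eq]
  refine Finset.sum_congr rfl fun i _ => ?_
  have : inner ℝ (gradient u x) (EuclideanSpace.single i (1 : ℝ))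
      = fderiv ℝ u x (EuclideanSpace.single i (1 : ℝ)) := by
    simp [gradient, InnerProductSpace.toDual_symm_apply]
  rw [← this, EuclideanSpace.inner_single_right]
  simp

lemma lap_pow {u : EuclideanSpace ℝ (Fin n) → ℝ} (hu : ContDiff ℝ 2 u) (k : ℕ)
    (x : EuclideanSpace ℝ (Fin n)) :
    lap (fun y => u y ^ (k + 2)) x
      = (k + 2) * u x ^ k * (u x * lap u x + (k + 1) * ‖gradient u x‖ ^ 2) := by
  have hu1 : Differentiable ℝ u := hu.differentiable two_ne_zero
  rw [norm_gradient_sq]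
  simp only [lap, Finset.mul_sum, ← Finset.sum_add_distrib]
  refine Finset.sum_congr rfl fun i _ => ?_
  have hd : Differentiable ℝ fun y => fderiv ℝ u y (EuclideanSpace.single i (1 : ℝ)) :=
    ((hu.fderiv_right (m := 1) (by norm_num)).clm_apply contDiff_const).differentiable one_ne_zero
  have h1 : (fun y => fderiv ℝ (fun y => u y ^ (k + 2)) y (EuclideanSpace.single i (1 : ℝ)))
      = fun y => ((k + 2) * u y ^ (k + 1)) *
        fderiv ℝ u y (EuclideanSpace.single i (1 : ℝ)) := by
    ext y
    rw [((hu1 y).hasFDerivAt.pow (k + 2)).fderiv]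
    simp
  have h2 := (((hu1 x).hasFDerivAt.pow (k + 1)).const_mul ((k : ℝ) + 2)).mul (hd x).hasFDerivAt
  rw [h1]
  erw [h2.fderiv]
  simp
  ring

lemma pow_sub_pow_le {a m M : ℝ} (hm : 0 ≤ m) (hma : m ≤ a) (haM : a ≤ M) (p : ℕ) :
    a ^ p - m ^ p ≤ p * M ^ (p - 1) * (a - m) := by
  rw [← (Commute.all a m).geom_sum₂_mul]
  refine mul_le_mul_of_nonneg_right ?_ (sub_nonneg.2 hma)
  have hM : 0 ≤ M := hm.trans (hma.trans haM)
  calc ∑ i ∈ Finset.range p, a ^ i * m ^ (p - 1 - i)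
      ≤ ∑ i ∈ Finset.range p, M ^ (p - 1) := by
        refine Finset.sum_le_sum fun i hi => ?_
        have hi' := Finset.mem_range.1 hi
        rw [show M ^ (p - 1) = M ^ i * M ^ (p - 1 - i) by rw [← pow_add]; congr 1; omega]
        have := hm.trans hma
        gcongr
        exact hma.trans haM
    _ = p * M ^ (p - 1) := by simp

/-- A bounded nonnegative superharmonic function `u` with `-u Δu ≤ K |∇u|²` is constant. -/
theorem eq_of_superharmonic_of_mul_lap_le {u : EuclideanSpace ℝ (Fin n) → ℝ}
    (hu : ContDiff ℝ 2 u) (hu0 : ∀ x, 0 ≤ u x) {M : ℝ} (huM : ∀ x, u x ≤ M)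
    (hlap : ∀ x, lap u x ≤ 0) {K : ℝ}
    (hK : ∀ x, -(u x * lap u x) ≤ K * ‖gradient u x‖ ^ 2) (x y : EuclideanSpace ℝ (Fin n)) :
    u x = u y := by
  obtain ⟨k, hk⟩ := exists_nat_ge K
  set c : ℝ := ∫ z : EuclideanSpace ℝ (Fin n), radialBump z with hc
  have hcpos : 0 < c := integral_radialBump_pos
  set m : ℝ := ⨅ x, u x with hm
  have hbdd : BddBelow (Set.range u) := ⟨0, by rintro _ ⟨x, rfl⟩; exact hu0 x⟩
  have hmu : ∀ x, m ≤ u x := fun x => ciInf_le hbdd x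
  have hm0 : 0 ≤ m := le_ciInf hu0
  have hM0 : 0 ≤ M := (hu0 0).trans (huM 0)
  have hsub : ∀ x, 0 ≤ lap (fun y => u y ^ (k + 2)) x := by
    intro x
    rw [lap_pow hu]
    have h1 := hK x
    have h2 : K * ‖gradient u x‖ ^ 2 ≤ (k + 1) * ‖gradient u x‖ ^ 2 := by
      gcongr; linarith
    have h3 := pow_nonneg (hu0 x) k
    have h4 : 0 ≤ u x * lap u x + (k + 1) * ‖gradient u x‖ ^ 2 := by linarith
    positivity
  set C : ℝ := (k + 2 : ℕ) * M ^ (k + 2 - 1) with hC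
  have hC0 : 0 ≤ C := by positivity
  have hbound : ∀ x y, c * (u x ^ (k + 2) - m ^ (k + 2)) ≤ C * (c * (u y - m)) := by
    intro x y
    have hlim := ((tendsto_bumpAverage_sub hu.continuous (M := M)
      (fun x => by rw [abs_of_nonneg (hu0 x)]; exact huM x) x y).add_const
        (c * (u y - m))).const_mul C
    rw [zero_add] at hlim
    refine ge_of_tendsto hlim ?_
    filter_upwards [eventually_ge_atTop 0] with t ht
    have hsupy := integral_radialBump_mul_le_of_lap_nonneg hu.neg
      (fun x => by
        have := lap_neg u x
        have h' := hlap x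
        change 0 ≤ lap (fun y => -u y) x
        linarith) y ht
    have hsubx := integral_radialBump_mul_le_of_lap_nonneg (hu.pow (k + 2)) hsub x ht
    simp only [mul_neg, integral_neg, neg_le_neg_iff] at hsupy
    have hut : Continuous fun z => u (x + t • z) := hu.continuous.comp (by fun_prop)
    have hI0 : Integrable fun z : EuclideanSpace ℝ (Fin n) => radialBump z :=
      continuous_radialBump.integrable_of_hasCompactSupport hasCompactSupport_radialBump
    have hI1 := integrable_radialBump_mul hut
    have hcmp : ∫ z, radialBump z * u (x + t • z) ^ (k + 2)
        ≤ ∫ z, ((m ^ (k + 2) - C * m) * radialBump z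
          + C * (radialBump z * u (x + t • z))) := by
      refine integral_mono (integrable_radialBump_mul (hut.pow (k + 2)))
        ((hI0.const_mul _).add (hI1.const_mul _)) fun z => ?_
      have h1 := mul_le_mul_of_nonneg_left
        (pow_sub_pow_le hm0 (hmu (x + t • z)) (huM _) (k + 2)) (radialBump_nonneg z)
      rw [← hC] at h1
      simp only
      linarith
    rw [integral_add (hI0.const_mul _) (hI1.const_mul _), integral_const_mul,
      integral_const_mul, ← hc] at hcmp
    have hCy := mul_le_mul_of_nonneg_left hsupy hC0
    linarith
  have hle : ∀ x, u x ≤ m := by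
    intro x
    have h1 : ∀ y, u x ^ (k + 2) - m ^ (k + 2) ≤ C * (u y - m) := by
      intro y
      have := hbound x y
      rw [mul_left_comm] at this
      exact le_of_mul_le_mul_left this hcpos
    have h2 : u x ^ (k + 2) - m ^ (k + 2) ≤ 0 := by
      refine le_of_forall_pos_le_add fun ε hε => ?_
      obtain ⟨y, hy⟩ := exists_lt_of_ciInf_lt
        (show ⨅ x, u x < m + ε / (C + 1) from lt_add_of_pos_right _ (by positivity))
      calc u x ^ (k + 2) - m ^ (k + 2) ≤ C * (u y - m) := h1 y
        _ ≤ (C + 1) * (ε / (C + 1)) := by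
          have := hmu y
          gcongr <;> linarith
        _ = 0 + ε := by field_simp; ring
    exact (pow_le_pow_iff_left₀ (hu0 x) hm0 (by omega : k + 2 ≠ 0)).1 (by linarith)
  exact ((hle x).trans (hmu y)).antisymm ((hle y).trans (hmu x))

end Liouville

/-- **Liouville theorem for systems** (Theorem 1.2(ii)): let `f, g` be nonnegative
nonlinearities such that for each `M > 0` there is `K(M) > 0` with
`u f(x,u,v,ξ,ζ) ≤ K(M)|ξ|²` and `v g(x,u,v,ξ,ζ) ≤ K(M)|ζ|²` for all `x ∈ ℝⁿ`,
`(u,v) ∈ [0,M]²` and all `ξ, ζ` in the closed ball of radius `M`.  Then any nonnegative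
classical solution `(u, v)` of `-Δu = f(x,u,v,∇u,∇v)`, `-Δv = g(x,u,v,∇u,∇v)` with
`u, v, |∇u|, |∇v|` bounded is constant. -/
theorem liouville_system_bounded_gradients {n : ℕ} (hn : 1 ≤ n)
    (f g : EuclideanSpace ℝ (Fin n) → ℝ → ℝ → EuclideanSpace ℝ (Fin n) →
      EuclideanSpace ℝ (Fin n) → ℝ)
    (hf_nonneg : ∀ x a b ξ ζ, 0 ≤ a → 0 ≤ b → 0 ≤ f x a b ξ ζ)
    (hg_nonneg : ∀ x a b ξ ζ, 0 ≤ a → 0 ≤ b → 0 ≤ g x a b ξ ζ)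
    (hK : ∀ M : ℝ, 0 < M → ∃ K : ℝ, 0 < K ∧
      ∀ x (a b : ℝ) (ξ ζ : EuclideanSpace ℝ (Fin n)),
        a ∈ Set.Icc (0 : ℝ) M → b ∈ Set.Icc (0 : ℝ) M →
          ξ ∈ Metric.closedBall (0 : EuclideanSpace ℝ (Fin n)) M →
          ζ ∈ Metric.closedBall (0 : EuclideanSpace ℝ (Fin n)) M →
          a * f x a b ξ ζ ≤ K * ‖ξ‖ ^ 2 ∧ b * g x a b ξ ζ ≤ K * ‖ζ‖ ^ 2)
    (u v : EuclideanSpace ℝ (Fin n) → ℝ)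
    (hu_nonneg : ∀ x, 0 ≤ u x) (hv_nonneg : ∀ x, 0 ≤ v x)
    (hu_bdd : ∃ M : ℝ, ∀ x, u x ≤ M) (hv_bdd : ∃ M : ℝ, ∀ x, v x ≤ M)
    (hgu_bdd : ∃ M : ℝ, ∀ x, ‖gradient u x‖ ≤ M)
    (hgv_bdd : ∃ M : ℝ, ∀ x, ‖gradient v x‖ ≤ M)
    (hu_C2 : ContDiff ℝ 2 u) (hv_C2 : ContDiff ℝ 2 v)
    (hequ : ∀ x, -lap u x = f x (u x) (v x) (gradient u x) (gradient v x))
    (heqv : ∀ x, -lap v x = g x (u x) (v x) (gradient u x) (gradient v x)) :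
    (∀ x y, u x = u y) ∧ (∀ x y, v x = v y) := by
  obtain ⟨M₁, h₁⟩ := hu_bdd
  obtain ⟨M₂, h₂⟩ := hv_bdd
  obtain ⟨M₃, h₃⟩ := hgu_bdd
  obtain ⟨M₄, h₄⟩ := hgv_bdd
  set M := max (max M₁ M₂) (max (max M₃ M₄) 1) with hM
  obtain ⟨K, -, hK⟩ := hK M (lt_of_lt_of_le one_pos (by simp [hM]))
  have key : ∀ x,
      u x * f x (u x) (v x) (gradient u x) (gradient v x) ≤ K * ‖gradient u x‖ ^ 2 ∧
      v x * g x (u x) (v x) (gradient u x) (gradient v x) ≤ K * ‖gradient v x‖ ^ 2 := fun x =>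
    hK x _ _ _ _ ⟨hu_nonneg x, (h₁ x).trans (by simp [hM])⟩
      ⟨hv_nonneg x, (h₂ x).trans (by simp [hM])⟩
      (mem_closedBall_zero_iff.2 ((h₃ x).trans (by simp [hM])))
      (mem_closedBall_zero_iff.2 ((h₄ x).trans (by simp [hM])))
  constructor
  · refine eq_of_superharmonic_of_mul_lap_le hu_C2 hu_nonneg h₁ (fun x => ?_) (K := K)
      fun x => ?_
    · have := hf_nonneg x _ _ (gradient u x) (gradient v x) (hu_nonneg x) (hv_nonneg x)
      linarith [hequ x]
    · rw [← mul_neg, hequ x]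
      exact (key x).1
  · refine eq_of_superharmonic_of_mul_lap_le hv_C2 hv_nonneg h₂ (fun x => ?_) (K := K)
      fun x => ?_
    · have := hg_nonneg x _ _ (gradient u x) (gradient v x) (hu_nonneg x) (hv_nonneg x)
      linarith [heqv x]
    · rw [← mul_neg, heqv x]
      exact (key x).2
end
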